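/- For all nonnegative integers p, q, the ℝ-algebra homomorphism from the Clifford algebra Cl(p,q) to the Clifford algebra Cl(p+1,q+1) induced by the isometric linear inclusion of ℝ^{p+q} into ℝ^{p+q+2} (mapping the standard basis vectors of square +1 and −1 to basis vectors of the same square, with the two extra basis directions of squares +1 and −1 unused) is injective; hence Cl(p,q) is a subalgebra of the conformal-type algebra Cl(p+1,q+1). -/

import Mathlib

/-- The diagonal quadratic form of signature `(p,q)` on `ℝ^{p+q}`: `p` coefficients `+1`
followed by `q` coefficients `-1`. -/
noncomputable def clpqForm (p q : ℕ) : QuadraticForm ℝ (Fin (p + q) → ℝ) :=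
  QuadraticMap.weightedSumSquares ℝ (fun i : Fin (p + q) => if (i : ℕ) < p then (1 : ℝ) else -1)

/-- The diagonal quadratic form of signature `(p+1,q+1)` on `ℝ^{p+q+2}`: `p+1` coefficients
`+1` followed by `q+1` coefficients `-1`. -/
noncomputable def clpq11Form (p q : ℕ) : QuadraticForm ℝ (Fin (p + q + 2) → ℝ) :=
  QuadraticMap.weightedSumSquares ℝ
    (fun i : Fin (p + q + 2) => if (i : ℕ) < p + 1 then (1 : ℝ) else -1)

/-- The index inclusion sending the `p` basis vectors of square `+1` of `ℝ^{p+q}` to basis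
vectors of square `+1` of `ℝ^{p+q+2}`, and the `q` basis vectors of square `-1` to basis
vectors of square `-1` (the two extra directions, one of square `+1` and one of square `-1`,
being unused). -/
def clIncl (p q : ℕ) (i : Fin (p + q)) : Fin (p + q + 2) :=
  if (i : ℕ) < p then ⟨(i : ℕ), by have := i.isLt; omega⟩
  else ⟨(i : ℕ) + 2, by have := i.isLt; omega⟩

namespace CliffordAlgebra

variable {R M N : Type*} [CommRing R] [AddCommGroup M] [Module R M] [AddCommGroup N] [Module R N]
  {Q : QuadraticForm R M} {Q' : QuadraticForm R N}

/-- Contraction by a functional vanishing on the image of an isometry kills the image of the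
induced map of Clifford algebras. -/
theorem contractLeft_map_eq_zero (f : Q →qᵢ Q') (d : Module.Dual R N) (hd : ∀ m, d (f m) = 0)
    (x : CliffordAlgebra Q) : contractLeft d (map f x) = 0 := by
  induction x using CliffordAlgebra.left_induction with
  | algebraMap r => rw [AlgHom.commutes, contractLeft_algebraMap]
  | add x y hx hy => rw [map_add, map_add, hx, hy, add_zero]
  | ι_mul x m hx => rw [map_mul, map_apply_ι, contractLeft_ι_mul, hd, hx, zero_smul, mul_zero,
      sub_zero]

/-- `changeForm` intertwines the maps induced by two isometries with the same underlying function,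
provided the bilinear form vanishes on their common image. -/
theorem changeForm_map {Q'' : QuadraticForm R N} {B : LinearMap.BilinForm R N}
    (h : B.toQuadraticMap = Q'' - Q') (f : Q →qᵢ Q') (f' : Q →qᵢ Q'') (hf : ∀ m, f' m = f m)
    (hB : ∀ m n, B (f m) (f n) = 0) (x : CliffordAlgebra Q) :
    changeForm h (map f x) = map f' x := by
  induction x using CliffordAlgebra.left_induction with
  | algebraMap r => rw [AlgHom.commutes, AlgHom.commutes, changeForm_algebraMap]
  | add x y hx hy => rw [map_add, map_add, map_add, hx, hy]
  | ι_mul x m hx =>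
    rw [map_mul, map_apply_ι, changeForm_ι_mul, hx, map_mul, map_apply_ι, hf,
      contractLeft_map_eq_zero f' (B (f m)) (fun n => by rw [hf, hB]), sub_zero]

/-- An isometry with a linear left inverse induces an injective map of Clifford algebras. -/
theorem map_injective_of_leftInverse [Invertible (2 : R)] (f : Q →qᵢ Q') (g : N →ₗ[R] M)
    (hg : ∀ m, g (f m) = m) : Function.Injective (map f) := by
  let f₀ : Q →qᵢ Q.comp g :=
    { f.toLinearMap with map_app' := fun m => congrArg Q (hg m) }
  let g₀ : Q.comp g →qᵢ Q := { g with map_app' := fun _ => rfl }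
  have h₀ : Function.Injective (map f₀) :=
    (leftInverse_map_of_leftInverse f₀ g₀ hg).injective
  have hQ (m : M) : (Q' - Q.comp g) (f m) = 0 := by
    simp [hg]
  have hB (m n : M) : QuadraticMap.associated (Q' - Q.comp g) (f₀ m) (f₀ n) = 0 := by
    change QuadraticMap.associated (Q' - Q.comp g) (f m) (f n) = 0
    rw [QuadraticMap.associated_apply, ← map_add, hQ, hQ, hQ]
    simp
  have h : (QuadraticMap.associated (Q' - Q.comp g)).toQuadraticMap = Q' - Q.comp g :=
    QuadraticMap.toQuadraticMap_associated R _
  intro x y hxy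
  apply h₀
  apply (changeFormEquiv h).injective
  change changeForm h (map f₀ x) = changeForm h (map f₀ y)
  rw [changeForm_map h f₀ f (fun _ => rfl) hB, changeForm_map h f₀ f (fun _ => rfl) hB, hxy]

end CliffordAlgebra

theorem clIncl_injective (p q : ℕ) : Function.Injective (clIncl p q) := by
  intro i j hij
  unfold clIncl at hij
  split_ifs at hij <;> simp only [Fin.mk.injEq] at hij <;> omega

/-- The ℝ-algebra homomorphism `Cl(p,q) → Cl(p+1,q+1)` induced by the isometric linear
inclusion of `ℝ^{p+q}` into `ℝ^{p+q+2}` (mapping standard basis vectors of square `+1`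
resp. `-1` to basis vectors of the same square) is injective; hence `Cl(p,q)` is a
subalgebra of the conformal-type algebra `Cl(p+1,q+1)`. -/
theorem clifford_map_to_conformal_injective (p q : ℕ)
    (f : clpqForm p q →qᵢ clpq11Form p q)
    (hf : ∀ i : Fin (p + q), f (Pi.single i 1) = Pi.single (clIncl p q i) (1 : ℝ)) :
    Function.Injective (CliffordAlgebra.map f) := by
  refine CliffordAlgebra.map_injective_of_leftInverse f (LinearMap.funLeft ℝ ℝ (clIncl p q)) ?_
  suffices h : LinearMap.funLeft ℝ ℝ (clIncl p q) ∘ₗ f.toLinearMap = LinearMap.id from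
    LinearMap.congr_fun h
  refine LinearMap.pi_ext' fun i => LinearMap.ext_ring (funext fun j => ?_)
  change f (Pi.single i 1) (clIncl p q j) = (Pi.single i 1 : Fin (p + q) → ℝ) j
  rw [hf]
  simp only [Pi.single_apply, (clIncl_injective p q).eq_iff]
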